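/- Under Assumption A, suppose (x₀,ξ₀) is forward nontrapping with respect to k, and let δ > 0 and the neighborhood Ω of (x₀,ξ₀) be as in the escape estimate (so that |y^λ(t;x,ξ)| ≥ c₁t − c₂ for 0 ≤ t ≤ λδ, (x,ξ) ∈ Ω, λ large). Then for every σ ∈ (0,δ) and every (x,ξ) ∈ Ω, lim_{λ→∞} exp(−σλ H_{p₀^λ}) ∘ exp(σλ H_{p^λ})(x,ξ) = S₊(x,ξ), where S₊(x,ξ) = lim_{t→+∞} exp(−tH_{k₀}) ∘ exp(tH_k)(x,ξ). -/

import Mathlib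

open Real Filter
open scoped BigOperators Topology

noncomputable section

/-- Euclidean configuration space `ℝⁿ`. -/
abbrev En (n : ℕ) := EuclideanSpace ℝ (Fin n)

/-- Partial derivative `∂f/∂x_j` of a function on `ℝⁿ`. -/
noncomputable def pd {n : ℕ} (f : En n → ℝ) (j : Fin n) (x : En n) : ℝ :=
  fderiv ℝ f x (EuclideanSpace.single j 1)

/-- Japanese bracket `⟨x⟩ = (1+|x|²)^{1/2}` on `ℝⁿ`. -/
noncomputable def jb {n : ℕ} (x : En n) : ℝ := Real.sqrt (1 + ‖x‖ ^ 2)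

/-- Japanese bracket `⟨t⟩` on `ℝ`. -/
noncomputable def jbR (t : ℝ) : ℝ := Real.sqrt (1 + t ^ 2)

/-- Kronecker delta. -/
def kdelta {n : ℕ} (j k : Fin n) : ℝ := if j = k then 1 else 0

/-- Assumption A: smooth symmetric positive-definite coefficients `a_{jk}` which are a
short-range perturbation of `δ_{jk}`, and a potential `V = O(⟨x⟩^{2-μ})`, with symbol-type
bounds on all derivatives. -/
structure AssumptionA (n : ℕ) (a : Fin n → Fin n → En n → ℝ) (V : En n → ℝ) (μ : ℝ) : Prop where
  n_pos : 0 < n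
  one_lt_mu : 1 < μ
  smooth_a : ∀ j k, ContDiff ℝ (⊤ : ℕ∞) (a j k)
  smooth_V : ContDiff ℝ (⊤ : ℕ∞) V
  symm : ∀ j k x, a j k x = a k j x
  posdef : ∀ x (ξ : En n), ξ ≠ 0 → 0 < ∑ j, ∑ k, a j k x * ξ j * ξ k
  decay_a : ∀ (m : ℕ) (j k : Fin n), ∃ C > 0, ∀ x,
      ‖iteratedFDeriv ℝ m (fun y => a j k y - kdelta j k) x‖ ≤ C * jb x ^ (-μ - (m : ℝ))
  decay_V : ∀ (m : ℕ), ∃ C > 0, ∀ x,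
      ‖iteratedFDeriv ℝ m V x‖ ≤ C * jb x ^ (2 - μ - (m : ℝ))

/-- Kinetic energy symbol `k(x,ξ) = ½ Σ a_{jk}(x) ξ_j ξ_k`. -/
noncomputable def ksym {n : ℕ} (a : Fin n → Fin n → En n → ℝ) (x ξ : En n) : ℝ :=
  (1 / 2) * ∑ j, ∑ k, a j k x * ξ j * ξ k

/-- Full symbol `p(x,ξ) = k(x,ξ) + ½|x|² + V(x)`. -/
noncomputable def psym {n : ℕ} (a : Fin n → Fin n → En n → ℝ) (V : En n → ℝ) (x ξ : En n) : ℝ :=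
  ksym a x ξ + ‖x‖ ^ 2 / 2 + V x

/-- Scaled symbol `p^λ(x,ξ) = k(x,ξ) + |x|²/(2λ²) + V(x)/λ²`. -/
noncomputable def plam {n : ℕ} (a : Fin n → Fin n → En n → ℝ) (V : En n → ℝ) (lam : ℝ)
    (x ξ : En n) : ℝ :=
  ksym a x ξ + ‖x‖ ^ 2 / (2 * lam ^ 2) + V x / lam ^ 2

/-- `(y,η)` is a (global) solution of the Hamilton equations of `k(x,ξ)=½Σa_{jk}(x)ξ_jξ_k`. -/
def IsFlowK {n : ℕ} (a : Fin n → Fin n → En n → ℝ) (y η : ℝ → En n) : Prop :=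
  (∀ t (j : Fin n), HasDerivAt (fun s => y s j) (∑ i, a j i (y t) * η t i) t) ∧
  (∀ t (j : Fin n), HasDerivAt (fun s => η s j)
      (-((1 / 2) * ∑ i, ∑ l, pd (a i l) j (y t) * η t i * η t l)) t)

/-- `(y,η)` is a (global) solution of the Hamilton equations of `p(x,ξ)`. -/
def IsFlowP {n : ℕ} (a : Fin n → Fin n → En n → ℝ) (V : En n → ℝ) (y η : ℝ → En n) : Prop :=
  (∀ t (j : Fin n), HasDerivAt (fun s => y s j) (∑ i, a j i (y t) * η t i) t) ∧
  (∀ t (j : Fin n), HasDerivAt (fun s => η s j)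
      (-((1 / 2) * ∑ i, ∑ l, pd (a i l) j (y t) * η t i * η t l + y t j + pd V j (y t))) t)

/-- `(y,η)` is a (global) solution of the Hamilton equations of `p^λ(x,ξ)`. -/
def IsFlowPlam {n : ℕ} (a : Fin n → Fin n → En n → ℝ) (V : En n → ℝ) (lam : ℝ)
    (y η : ℝ → En n) : Prop :=
  (∀ t (j : Fin n), HasDerivAt (fun s => y s j) (∑ i, a j i (y t) * η t i) t) ∧
  (∀ t (j : Fin n), HasDerivAt (fun s => η s j)
      (-((1 / 2) * ∑ i, ∑ l, pd (a i l) j (y t) * η t i * η t l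
          + y t j / lam ^ 2 + pd V j (y t) / lam ^ 2)) t)

/-- First (position) component of `exp(-tH_{p₀^λ})` applied to `(y t, η t)`:
`z^λ(t) = cos(t/λ) y^λ(t) − λ sin(t/λ) η^λ(t)`. -/
noncomputable def zlam {n : ℕ} (lam : ℝ) (y η : ℝ → En n) (t : ℝ) : En n :=
  Real.cos (t / lam) • y t - (lam * Real.sin (t / lam)) • η t

/-- Second (momentum) component: `ζ^λ(t) = λ⁻¹ sin(t/λ) y^λ(t) + cos(t/λ) η^λ(t)`. -/
noncomputable def zetalam {n : ℕ} (lam : ℝ) (y η : ℝ → En n) (t : ℝ) : En n :=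
  (lam⁻¹ * Real.sin (t / lam)) • y t + Real.cos (t / lam) • η t

end

/-- The velocity field `∂_ξ k(x,ξ)`. -/
noncomputable def velocity {n : ℕ} (a : Fin n → Fin n → En n → ℝ) (x ξ : En n) : En n :=
  WithLp.toLp 2 fun j => ∑ i, a j i x * ξ i

/-- The gradient `∂_x k(x,ξ)` of the kinetic energy in position. -/
noncomputable def kinGrad {n : ℕ} (a : Fin n → Fin n → En n → ℝ) (x ξ : En n) : En n :=
  WithLp.toLp 2 fun j => (1 / 2) * ∑ i, ∑ l, pd (a i l) j x * ξ i * ξ l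

/-- The gradient of a potential, in coordinates. -/
noncomputable def potGrad {n : ℕ} (V : En n → ℝ) (x : En n) : En n :=
  WithLp.toLp 2 fun j => pd V j x

lemma one_le_jb {n : ℕ} (x : En n) : 1 ≤ jb x := by
  rw [jb, Real.one_le_sqrt]
  nlinarith [sq_nonneg ‖x‖]

lemma norm_le_jb {n : ℕ} (x : En n) : ‖x‖ ≤ jb x :=
  Real.le_sqrt_of_sq_le (by linarith)

lemma jb_le_one_add_norm {n : ℕ} (x : En n) : jb x ≤ 1 + ‖x‖ := by
  rw [jb, Real.sqrt_le_left (by positivity)]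
  nlinarith [norm_nonneg x]

lemma norm_le_card_mul_of_coord_le {n : ℕ} (v : En n) (C : ℝ) (h : ∀ j, |v j| ≤ C) :
    ‖v‖ ≤ n * C := by
  calc ‖v‖ = ‖∑ j, v j • EuclideanSpace.single j (1 : ℝ)‖ := by
        congr 1
        ext i
        simp [Pi.single_apply]
    _ ≤ ∑ j, ‖v j • EuclideanSpace.single j (1 : ℝ)‖ := norm_sum_le _ _
    _ ≤ ∑ _j : Fin n, C := by
        refine Finset.sum_le_sum fun j _ => ?_
        rw [norm_smul]
        simpa using h j
    _ = n * C := by simp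

lemma abs_coord_le_norm {n : ℕ} (v : En n) (j : Fin n) : |v j| ≤ ‖v‖ := by
  simpa using PiLp.norm_apply_le v j

lemma abs_pd_le {n : ℕ} (f : En n → ℝ) (j : Fin n) (x : En n) : |pd f j x| ≤ ‖fderiv ℝ f x‖ := by
  have := (fderiv ℝ f x).le_opNorm (EuclideanSpace.single j (1 : ℝ))
  simpa [pd] using this

lemma hasDerivAt_of_coord {n : ℕ} {f : ℝ → En n} {f' : En n} {t : ℝ}
    (h : ∀ j, HasDerivAt (fun s => f s j) (f' j) t) : HasDerivAt f f' t :=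
  HasFDerivAt.comp_hasDerivAt (f := fun s j => f s j) (f' := fun j => f' j) t
    (PiLp.hasFDerivAt_toLp (𝕜 := ℝ) (E := fun _ : Fin n => ℝ) 2 (fun j => f t j))
    (hasDerivAt_pi.2 h)

lemma HasDerivAt.coord {n : ℕ} {f : ℝ → En n} {f' : En n} {t : ℝ} (h : HasDerivAt f f' t)
    (j : Fin n) : HasDerivAt (fun s => f s j) (f' j) t :=
  (PiLp.hasFDerivAt_apply (𝕜 := ℝ) 2 (f t) j).comp_hasDerivAt t h

lemma IsFlowK.hasDerivAt_fst {n : ℕ} {a : Fin n → Fin n → En n → ℝ} {y η : ℝ → En n}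
    (h : IsFlowK a y η) (t : ℝ) : HasDerivAt y (velocity a (y t) (η t)) t :=
  hasDerivAt_of_coord (h.1 t)

lemma IsFlowK.hasDerivAt_snd {n : ℕ} {a : Fin n → Fin n → En n → ℝ} {y η : ℝ → En n}
    (h : IsFlowK a y η) (t : ℝ) : HasDerivAt η (-kinGrad a (y t) (η t)) t :=
  hasDerivAt_of_coord (h.2 t)

lemma IsFlowPlam.hasDerivAt_fst {n : ℕ} {a : Fin n → Fin n → En n → ℝ} {V : En n → ℝ} {lam : ℝ}
    {y η : ℝ → En n} (h : IsFlowPlam a V lam y η) (t : ℝ) :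
    HasDerivAt y (velocity a (y t) (η t)) t :=
  hasDerivAt_of_coord (h.1 t)

lemma IsFlowPlam.hasDerivAt_snd {n : ℕ} {a : Fin n → Fin n → En n → ℝ} {V : En n → ℝ} {lam : ℝ}
    {y η : ℝ → En n} (h : IsFlowPlam a V lam y η) (t : ℝ) :
    HasDerivAt η (-(kinGrad a (y t) (η t) + (lam ^ 2)⁻¹ • (y t + potGrad V (y t)))) t := by
  refine hasDerivAt_of_coord fun j => ?_
  convert h.2 t j using 1
  simp only [kinGrad, potGrad, PiLp.neg_apply, PiLp.add_apply, PiLp.smul_apply, smul_eq_mul]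
  ring

section Estimates

variable {n : ℕ} {a : Fin n → Fin n → En n → ℝ} {V : En n → ℝ} {μ : ℝ}

lemma AssumptionA.exists_coeff_bound (hA : AssumptionA n a V μ) :
    ∃ C > 0, ∀ j k x, |a j k x - kdelta j k| ≤ C * jb x ^ (-μ) ∧
      ‖fderiv ℝ (a j k) x‖ ≤ C * jb x ^ (-μ - 1) := by
  choose C₀ _ h₀ using hA.decay_a 0
  choose C₁ _ h₁ using hA.decay_a 1
  obtain ⟨M₀, hM₀⟩ := Finite.exists_le fun p : Fin n × Fin n => C₀ p.1 p.2
  obtain ⟨M₁, hM₁⟩ := Finite.exists_le fun p : Fin n × Fin n => C₁ p.1 p.2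
  refine ⟨max 1 (max M₀ M₁), by positivity, fun j k x => ⟨?_, ?_⟩⟩
  · have h := h₀ j k x
    rw [norm_iteratedFDeriv_zero, Real.norm_eq_abs, Nat.cast_zero, sub_zero] at h
    refine h.trans (mul_le_mul_of_nonneg_right ?_ (Real.rpow_nonneg (Real.sqrt_nonneg _) _))
    exact (hM₀ (j, k)).trans ((le_max_left _ _).trans (le_max_right _ _))
  · have h := h₁ j k x
    rw [norm_iteratedFDeriv_one, fderiv_sub_const, Nat.cast_one] at h
    refine h.trans (mul_le_mul_of_nonneg_right ?_ (Real.rpow_nonneg (Real.sqrt_nonneg _) _))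
    exact (hM₁ (j, k)).trans ((le_max_right _ _).trans (le_max_right _ _))

lemma AssumptionA.exists_field_bound (hA : AssumptionA n a V μ) :
    ∃ C > 0, (∀ x ξ, ‖velocity a x ξ - ξ‖ ≤ C * jb x ^ (-μ) * ‖ξ‖) ∧
      (∀ x ξ, ‖kinGrad a x ξ‖ ≤ C * jb x ^ (-μ - 1) * ‖ξ‖ ^ 2) ∧
      (∀ x, ‖potGrad V x‖ ≤ C * jb x ^ (1 - μ)) ∧ (∀ x, |V x| ≤ C * jb x ^ (2 - μ)) := by
  obtain ⟨C, hC, h⟩ := hA.exists_coeff_bound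
  obtain ⟨D₀, hD₀, h₀⟩ := hA.decay_V 0
  obtain ⟨D₁, hD₁, h₁⟩ := hA.decay_V 1
  have hn : (1 : ℝ) ≤ n := by exact_mod_cast hA.n_pos
  have hpos : ∀ (x : En n) (s : ℝ), 0 ≤ jb x ^ s := fun x s =>
    Real.rpow_nonneg (Real.sqrt_nonneg _) _
  have hle : ∀ {K : ℝ} (x : En n) (s : ℝ), K ≤ n ^ 3 * C + n * D₁ + D₀ →
      K * jb x ^ s ≤ (n ^ 3 * C + n * D₁ + D₀) * jb x ^ s :=
    fun x s hK => mul_le_mul_of_nonneg_right hK (hpos x s)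
  have e1 : (n : ℝ) ^ 2 * C ≤ n ^ 3 * C :=
    mul_le_mul_of_nonneg_right (pow_le_pow_right₀ hn (by norm_num)) hC.le
  have e2 : (0 : ℝ) < n * D₁ := by positivity
  have e3 : (0 : ℝ) < n ^ 3 * C := by positivity
  refine ⟨n ^ 3 * C + n * D₁ + D₀, by positivity, fun x ξ => ?_, fun x ξ => ?_, fun x => ?_,
    fun x => ?_⟩
  · have hb : ‖velocity a x ξ - ξ‖ ≤ n * (n * (C * jb x ^ (-μ) * ‖ξ‖)) := by
      refine norm_le_card_mul_of_coord_le _ _ fun j => ?_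
      have : (velocity a x ξ - ξ) j = ∑ i, (a j i x - kdelta j i) * ξ i := by
        simp [velocity, sub_mul, Finset.sum_sub_distrib, kdelta]
      rw [this]
      refine (Finset.abs_sum_le_sum_abs _ _).trans ?_
      calc ∑ i, |(a j i x - kdelta j i) * ξ i| ≤ ∑ _i : Fin n, C * jb x ^ (-μ) * ‖ξ‖ := by
            refine Finset.sum_le_sum fun i _ => ?_
            rw [abs_mul]
            exact mul_le_mul (h j i x).1 (abs_coord_le_norm ξ i) (abs_nonneg _)
              (mul_nonneg hC.le (hpos _ _))
        _ = _ := by simp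
    refine hb.trans ?_
    have := mul_le_mul_of_nonneg_right (hle x (-μ) (K := n ^ 2 * C) (by linarith)) (norm_nonneg ξ)
    linarith
  · have hb : ‖kinGrad a x ξ‖ ≤ n * (n * (n * (C * jb x ^ (-μ - 1) * ‖ξ‖ * ‖ξ‖))) := by
      refine norm_le_card_mul_of_coord_le _ _ fun j => ?_
      have hs : |∑ i, ∑ l, pd (a i l) j x * ξ i * ξ l| ≤
          n * (n * (C * jb x ^ (-μ - 1) * ‖ξ‖ * ‖ξ‖)) := by
        calc |∑ i, ∑ l, pd (a i l) j x * ξ i * ξ l|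
            ≤ ∑ i, ∑ l, |pd (a i l) j x * ξ i * ξ l| :=
              (Finset.abs_sum_le_sum_abs _ _).trans
                (Finset.sum_le_sum fun i _ => Finset.abs_sum_le_sum_abs _ _)
          _ ≤ ∑ _i : Fin n, ∑ _l : Fin n, C * jb x ^ (-μ - 1) * ‖ξ‖ * ‖ξ‖ := by
              refine Finset.sum_le_sum fun i _ => Finset.sum_le_sum fun l _ => ?_
              rw [abs_mul, abs_mul]
              have h2 := hpos x (-μ - 1)
              have h3 := (abs_pd_le (a i l) j x).trans (h i l x).2
              gcongr
              · exact abs_coord_le_norm ξ i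
              · exact abs_coord_le_norm ξ l
          _ = _ := by simp
      simp only [kinGrad]
      rw [abs_mul, abs_of_pos (by norm_num : (0 : ℝ) < 1 / 2)]
      linarith [abs_nonneg (∑ i, ∑ l, pd (a i l) j x * ξ i * ξ l)]
    refine hb.trans ?_
    have := mul_le_mul_of_nonneg_right (hle x (-μ - 1) (K := n ^ 3 * C) (by linarith))
      (sq_nonneg ‖ξ‖)
    linarith
  · have hb : ‖potGrad V x‖ ≤ n * (D₁ * jb x ^ (1 - μ)) := by
      refine norm_le_card_mul_of_coord_le _ _ fun j => (abs_pd_le V j x).trans ?_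
      have := h₁ x
      rw [norm_iteratedFDeriv_one, Nat.cast_one] at this
      rwa [show 2 - μ - 1 = 1 - μ by ring] at this
    linarith [hle x (1 - μ) (K := n * D₁) (by linarith)]
  · have hb := h₀ x
    rw [norm_iteratedFDeriv_zero, Real.norm_eq_abs, Nat.cast_zero, sub_zero] at hb
    linarith [hle x (2 - μ) (K := D₀) (by linarith)]

lemma ksym_eq_inner (x ξ : En n) : ksym a x ξ = (1 / 2) * inner ℝ (velocity a x ξ) ξ := by
  simp only [ksym, velocity, PiLp.inner_apply, RCLike.inner_apply, conj_trivial, Finset.mul_sum]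
  refine Finset.sum_congr rfl fun j _ => Finset.sum_congr rfl fun k _ => ?_
  ring

lemma AssumptionA.exists_elliptic (hA : AssumptionA n a V μ) :
    ∃ c > 0, ∀ x ξ, c * ‖ξ‖ ^ 2 ≤ ksym a x ξ := by
  obtain ⟨C, hC, hv, -⟩ := hA.exists_field_bound
  have hsph : ∀ c, (∀ x ξ : En n, ‖ξ‖ = 1 → c ≤ ksym a x ξ) →
      ∀ x ξ : En n, c * ‖ξ‖ ^ 2 ≤ ksym a x ξ := by
    intro c h x ξ
    rcases eq_or_ne ξ 0 with rfl | hξ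
    · simp [ksym]
    have hξ' : 0 < ‖ξ‖ := norm_pos_iff.2 hξ
    have := h x (‖ξ‖⁻¹ • ξ) (by rw [norm_smul, norm_inv, norm_norm, inv_mul_cancel₀ hξ'.ne'])
    have e : ksym a x (‖ξ‖⁻¹ • ξ) = (‖ξ‖ ^ 2)⁻¹ * ksym a x ξ := by
      simp only [ksym, PiLp.smul_apply, smul_eq_mul, Finset.mul_sum]
      refine Finset.sum_congr rfl fun j _ => Finset.sum_congr rfl fun k _ => ?_
      field_simp
    rw [e, inv_mul_eq_div, le_div_iff₀ (by positivity)] at this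
    exact this
  -- near infinity the form is close to the Euclidean one
  have hfar : ∀ x ξ : En n, 2 * C ≤ ‖x‖ → ‖ξ‖ = 1 → 1 / 4 ≤ ksym a x ξ := by
    intro x ξ hx hξ
    have h1 : C * jb x ^ (-μ) ≤ 1 / 2 := by
      have hj : jb x ^ (-μ) ≤ (jb x)⁻¹ := by
        rw [← Real.rpow_neg_one]
        exact Real.rpow_le_rpow_of_exponent_le (one_le_jb x) (by linarith [hA.one_lt_mu])
      have hj1 := one_le_jb x
      have : C * (jb x)⁻¹ ≤ 1 / 2 := by
        rw [← div_eq_mul_inv, div_le_iff₀ (by linarith)]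
        linarith [norm_le_jb x]
      exact (mul_le_mul_of_nonneg_left hj hC.le).trans this
    have h2 := hv x ξ
    rw [hξ, mul_one] at h2
    have h3 := abs_real_inner_le_norm (velocity a x ξ - ξ) ξ
    rw [inner_sub_left, real_inner_self_eq_norm_sq, hξ, one_pow, mul_one] at h3
    rw [ksym_eq_inner]
    linarith [(abs_le.1 h3).1]
  have hcont : Continuous fun p : En n × En n => ksym a p.1 p.2 := by
    unfold ksym
    have := fun j k => (hA.smooth_a j k).continuous
    fun_prop
  have hcpt : IsCompact (Metric.closedBall (0 : En n) (2 * C) ×ˢ Metric.sphere (0 : En n) 1) :=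
    (isCompact_closedBall _ _).prod (isCompact_sphere _ _)
  have hne : (Metric.closedBall (0 : En n) (2 * C) ×ˢ Metric.sphere (0 : En n) 1).Nonempty := by
    refine ⟨(0, EuclideanSpace.single ⟨0, hA.n_pos⟩ 1), ?_, ?_⟩
    · simpa using hC.le
    · simp
  obtain ⟨p, hp, hmin⟩ := hcpt.exists_isMinOn hne hcont.continuousOn
  have hp0 : 0 < ksym a p.1 p.2 := by
    have := hA.posdef p.1 p.2 (fun h => by have := hp.2; simp [h] at this)
    unfold ksym
    linarith
  refine ⟨min (1 / 4) (ksym a p.1 p.2), lt_min (by norm_num) hp0, hsph _ fun x ξ hξ => ?_⟩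
  rcases le_total (2 * C) ‖x‖ with hx | hx
  · exact (min_le_left _ _).trans (hfar x ξ hx hξ)
  · exact (min_le_right _ _).trans (hmin (a := (x, ξ)) ⟨by simpa using hx, by simpa using hξ⟩)

lemma fderiv_eq_inner_potGrad (f : En n → ℝ) (x v : En n) :
    fderiv ℝ f x v = inner ℝ (potGrad f x) v := by
  have hv : v = ∑ j, v j • EuclideanSpace.single j (1 : ℝ) := by
    ext i
    simp [Pi.single_apply]
  conv_lhs => rw [hv]
  simp [map_sum, potGrad, PiLp.inner_apply, pd]

lemma IsFlowPlam.plam_eq (hA : AssumptionA n a V μ) {lam : ℝ} {y η : ℝ → En n}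
    (h : IsFlowPlam a V lam y η) (t : ℝ) :
    plam a V lam (y t) (η t) = plam a V lam (y 0) (η 0) := by
  have key : ∀ t, HasDerivAt (fun s => plam a V lam (y s) (η s)) 0 t := by
    intro t
    set v := velocity a (y t) (η t) with hvdef
    set f := -(kinGrad a (y t) (η t) + (lam ^ 2)⁻¹ • (y t + potGrad V (y t))) with hf
    have hy : HasDerivAt y v t := h.hasDerivAt_fst t
    have hη : HasDerivAt η f t := h.hasDerivAt_snd t
    have hηj : ∀ j, HasDerivAt (fun s => η s j) (f j) t := hη.coord
    have hcomp : ∀ {g : En n → ℝ}, ContDiff ℝ (⊤ : ℕ∞) g →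
        HasDerivAt (fun s => g (y s)) (inner ℝ (potGrad g (y t)) v) t := fun {g} hg => by
      rw [← fderiv_eq_inner_potGrad]
      exact ((hg.differentiable (by simp)) (y t)).hasFDerivAt.comp_hasDerivAt t hy
    have hk := (HasDerivAt.fun_sum fun j (_ : j ∈ Finset.univ) =>
      HasDerivAt.fun_sum fun k (_ : k ∈ Finset.univ) =>
        ((hcomp (hA.smooth_a j k)).mul (hηj j)).mul (hηj k)).const_mul (1 / 2 : ℝ)
    have hn := (hy.norm_sq).div_const (2 * lam ^ 2)
    have hV := (hcomp hA.smooth_V).div_const (lam ^ 2)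
    have htot := (hk.add hn).add hV
    refine htot.congr_deriv ?_
    have hkin : (1 / 2 : ℝ) * ∑ j, ∑ k, inner ℝ (potGrad (a j k) (y t)) v * η t j * η t k
        = inner ℝ (kinGrad a (y t) (η t)) v := by
      simp only [potGrad, kinGrad, PiLp.inner_apply, RCLike.inner_apply, conj_trivial,
        Finset.mul_sum, Finset.sum_mul]
      rw [Finset.sum_comm_cycle]
      refine Finset.sum_congr rfl fun l _ => Finset.sum_congr rfl fun j _ =>
        Finset.sum_congr rfl fun k _ => ?_
      ring
    have hvel : (1 / 2 : ℝ) * ∑ j, ∑ k, (a j k (y t) * f j * η t k + a j k (y t) * η t j * f k)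
        = inner ℝ v f := by
      have e1 : ∑ j, ∑ k, a j k (y t) * f j * η t k = inner ℝ v f := by
        simp only [hvdef, velocity, PiLp.inner_apply, RCLike.inner_apply, conj_trivial,
          Finset.mul_sum]
        refine Finset.sum_congr rfl fun j _ => Finset.sum_congr rfl fun k _ => ?_
        ring
      have e2 : ∑ j, ∑ k, a j k (y t) * η t j * f k = inner ℝ v f := by
        rw [← e1, Finset.sum_comm]
        refine Finset.sum_congr rfl fun j _ => Finset.sum_congr rfl fun k _ => ?_
        rw [hA.symm k j]
        ring
      simp only [Finset.sum_add_distrib, e1, e2]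
      ring
    have hsplit : (1 / 2 : ℝ) * ∑ j, ∑ k, ((inner ℝ (potGrad (a j k) (y t)) v * η t j
          + a j k (y t) * f j) * η t k + a j k (y t) * η t j * f k)
        = inner ℝ (kinGrad a (y t) (η t)) v + inner ℝ v f := by
      rw [← hkin, ← hvel, ← mul_add, ← Finset.sum_add_distrib]
      simp only [← Finset.sum_add_distrib]
      congr 1
      refine Finset.sum_congr rfl fun j _ => Finset.sum_congr rfl fun k _ => ?_
      ring
    simp only [Pi.mul_apply]
    rw [hsplit, hf, inner_neg_right, inner_add_right, inner_smul_right, inner_add_right,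
      real_inner_comm v, real_inner_comm v, real_inner_comm v]
    ring
  exact is_const_of_deriv_eq_zero (fun t => (key t).differentiableAt) (fun t => (key t).deriv) t 0

lemma AssumptionA.exists_momentum_bound (hA : AssumptionA n a V μ) (x ξ : En n) :
    ∃ M > 0, ∀ lam : ℝ, 1 ≤ lam → ∀ y η : ℝ → En n, IsFlowPlam a V lam y η → y 0 = x → η 0 = ξ →
      ∀ t, ‖η t‖ ≤ M := by
  obtain ⟨c, hc, hell⟩ := hA.exists_elliptic
  obtain ⟨C, hC, -, -, -, hV⟩ := hA.exists_field_bound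
  set B := |ksym a x ξ| + ‖x‖ ^ 2 / 2 + |V x| + C + C ^ 2 / 2 with hB
  have hBpos : 0 < B := by positivity
  refine ⟨Real.sqrt (B / c), Real.sqrt_pos.2 (by positivity), fun lam hlam y η h hy hη t => ?_⟩
  apply Real.le_sqrt_of_sq_le
  rw [le_div_iff₀ hc]
  have hE := h.plam_eq hA t
  rw [hy, hη, plam, plam] at hE
  have h1 := hell (y t) (η t)
  set r := (lam ^ 2)⁻¹ with hr
  have hr0 : 0 ≤ r := by positivity
  have hr1 : r ≤ 1 := inv_le_one_of_one_le₀ (one_le_pow₀ hlam)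
  have hE' : ksym a (y t) (η t) + r * (‖y t‖ ^ 2 / 2 + V (y t))
      = ksym a x ξ + r * (‖x‖ ^ 2 / 2 + V x) := by
    rw [div_eq_mul_inv, mul_inv, div_eq_mul_inv (V _), div_eq_mul_inv (‖x‖ ^ 2), mul_inv,
      div_eq_mul_inv (V _), ← hr] at hE
    linarith
  have hVy : |V (y t)| ≤ C * (1 + ‖y t‖) := by
    refine (hV _).trans (mul_le_mul_of_nonneg_left ?_ hC.le)
    calc jb (y t) ^ (2 - μ) ≤ jb (y t) ^ (1 : ℝ) :=
          Real.rpow_le_rpow_of_exponent_le (one_le_jb _) (by linarith [hA.one_lt_mu])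
      _ ≤ 1 + ‖y t‖ := by simpa using jb_le_one_add_norm (y t)
  have h2 : -(C + C ^ 2 / 2) ≤ ‖y t‖ ^ 2 / 2 + V (y t) := by
    nlinarith [neg_abs_le (V (y t)), sq_nonneg (‖y t‖ - C)]
  have h3 : -(C + C ^ 2 / 2) ≤ r * (‖y t‖ ^ 2 / 2 + V (y t)) := by
    have : 0 ≤ C + C ^ 2 / 2 := by positivity
    nlinarith
  have h4 : r * (‖x‖ ^ 2 / 2 + V x) ≤ ‖x‖ ^ 2 / 2 + |V x| := by
    have : 0 ≤ ‖x‖ ^ 2 / 2 + |V x| := by positivity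
    nlinarith [le_abs_self (V x)]
  linarith [le_abs_self (ksym a x ξ)]

lemma IsFlowPlam.hasDerivAt_zlam {lam : ℝ} (hlam : lam ≠ 0) {y η : ℝ → En n}
    (h : IsFlowPlam a V lam y η) (t : ℝ) :
    HasDerivAt (zlam lam y η)
      (Real.cos (t / lam) • (velocity a (y t) (η t) - η t)
        + (lam * Real.sin (t / lam)) • kinGrad a (y t) (η t)
        + (Real.sin (t / lam) / lam) • potGrad V (y t)) t := by
  have hd := (hasDerivAt_id t).div_const lam
  have h1 := (hd.cos).smul (h.hasDerivAt_fst t)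
  have h2 := ((hd.sin).const_mul lam).smul (h.hasDerivAt_snd t)
  refine (h1.sub h2).congr_deriv ?_
  ext j
  simp only [id, PiLp.neg_apply, PiLp.add_apply, PiLp.sub_apply, PiLp.smul_apply, smul_eq_mul]
  field_simp
  ring

lemma IsFlowPlam.hasDerivAt_zetalam {lam : ℝ} (hlam : lam ≠ 0) {y η : ℝ → En n}
    (h : IsFlowPlam a V lam y η) (t : ℝ) :
    HasDerivAt (zetalam lam y η)
      ((Real.sin (t / lam) / lam) • (velocity a (y t) (η t) - η t)
        - Real.cos (t / lam) • kinGrad a (y t) (η t)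
        - (Real.cos (t / lam) / lam ^ 2) • potGrad V (y t)) t := by
  have hd := (hasDerivAt_id t).div_const lam
  have h1 := ((hd.sin).const_mul lam⁻¹).smul (h.hasDerivAt_fst t)
  have h2 := (hd.cos).smul (h.hasDerivAt_snd t)
  refine (h1.add h2).congr_deriv ?_
  ext j
  simp only [id, PiLp.neg_apply, PiLp.add_apply, PiLp.sub_apply, PiLp.smul_apply, smul_eq_mul]
  field_simp
  ring

lemma norm_sub_le_of_deriv_le_rpow {f f' : ℝ → En n} {K s b T : ℝ} (hs : 1 < s) (hK : 0 ≤ K)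
    (hT : 0 ≤ T) (hTb : T ≤ b) (hf : ∀ t ∈ Set.Icc T b, HasDerivAt f (f' t) t)
    (hbound : ∀ t ∈ Set.Icc T b, ‖f' t‖ ≤ K * (1 + t) ^ (-s)) :
    ‖f b - f T‖ ≤ K / (s - 1) * (1 + T) ^ (1 - s) := by
  have hB : ∀ t ∈ Set.Icc T b, HasDerivAt
      (fun t => K / (s - 1) * ((1 + T) ^ (1 - s) - (1 + t) ^ (1 - s))) (K * (1 + t) ^ (-s)) t := by
    intro t ht
    have h1 : HasDerivAt (fun t : ℝ => 1 + t) 1 t := (hasDerivAt_id t).const_add 1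
    have h2 := (h1.rpow_const (p := 1 - s) (Or.inl (by linarith [ht.1]))).const_sub
      ((1 + T) ^ (1 - s)) |>.const_mul (K / (s - 1))
    refine h2.congr_deriv ?_
    rw [show 1 - s - 1 = -s by ring]
    have : s - 1 ≠ 0 := by linarith
    field_simp
    ring
  have h := image_norm_le_of_norm_deriv_right_le_deriv_boundary' (f := fun t => f t - f T)
    (a := T) (b := b)
    (fun t ht => ((hf t ht).sub_const (f T)).continuousAt.continuousWithinAt)
    (fun t ht => ((hf t (Set.Ico_subset_Icc_self ht)).sub_const (f T)).hasDerivWithinAt)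
    (by simp) (fun t ht => (hB t ht).continuousAt.continuousWithinAt)
    (fun t ht => (hB t (Set.Ico_subset_Icc_self ht)).hasDerivWithinAt)
    (fun t ht => hbound t (Set.Ico_subset_Icc_self ht)) (Set.right_mem_Icc.2 hTb)
  refine h.trans (mul_le_mul_of_nonneg_left ?_ (div_nonneg hK (by linarith)))
  have : 0 ≤ (1 + b) ^ (1 - s) := Real.rpow_nonneg (by linarith) _
  linarith

/-- Along an escaping trajectory with bounded momentum, the interaction-picture derivatives decay
like `t ^ (-μ)`, uniformly in `λ` on `[0, σλ]`. -/
lemma AssumptionA.exists_deriv_bound (hA : AssumptionA n a V μ) {c₁ c₂ σ M : ℝ} (hc₁ : 0 < c₁)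
    (hc₂ : 0 < c₂) (hσ : 0 < σ) (hM : 0 < M) :
    ∃ K > 0, ∀ (lam t : ℝ) (y η : En n), 1 ≤ lam → 0 ≤ t → t ≤ σ * lam → c₁ * t - c₂ ≤ ‖y‖ →
      ‖η‖ ≤ M →
      ‖Real.cos (t / lam) • (velocity a y η - η) + (lam * Real.sin (t / lam)) • kinGrad a y η
        + (Real.sin (t / lam) / lam) • potGrad V y‖ ≤ K * (1 + t) ^ (-μ) ∧
      ‖(Real.sin (t / lam) / lam) • (velocity a y η - η) - Real.cos (t / lam) • kinGrad a y η
        - (Real.cos (t / lam) / lam ^ 2) • potGrad V y‖ ≤ K * (1 + t) ^ (-μ) := by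
  obtain ⟨C, hC, hv, hk, hp, -⟩ := hA.exists_field_bound
  have hμ := hA.one_lt_mu
  set c := c₁ / (1 + c₁ + c₂) with hcdef
  have hc : 0 < c := by positivity
  have hcμ : 0 < c ^ (-μ) := Real.rpow_pos_of_pos hc _
  refine ⟨(C * M + C * M ^ 2 / c + C * c * (1 + σ) ^ 2) * c ^ (-μ), by positivity,
    fun lam t y η hlam ht htσ hy hη => ?_⟩
  have hw : 0 < 1 + t := by linarith
  have hl0 : 0 < lam := by linarith
  have hjb : c * (1 + t) ≤ jb y := by
    rw [hcdef, div_mul_eq_mul_div, div_le_iff₀ (by positivity)]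
    nlinarith [one_le_jb y, norm_le_jb y]
  set D := (c * (1 + t)) ^ (-μ) with hD
  have hDpos : 0 < D := Real.rpow_pos_of_pos (by positivity) _
  have hDeq : D = c ^ (-μ) * (1 + t) ^ (-μ) := Real.mul_rpow hc.le hw.le
  have hdec : ∀ s : ℝ, s ≤ 0 → jb y ^ s ≤ (c * (1 + t)) ^ s := fun s hs =>
    Real.rpow_le_rpow_of_nonpos (by positivity) hjb hs
  have hcw : c * (1 + t) ≠ 0 := (mul_pos hc hw).ne'
  have d1 : jb y ^ (-μ) ≤ D := hdec _ (by linarith)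
  have d2 : jb y ^ (-μ - 1) ≤ D / (c * (1 + t)) := by
    have := hdec (-μ - 1) (by linarith)
    rwa [Real.rpow_sub_one hcw] at this
  have d3 : jb y ^ (1 - μ) ≤ D * (c * (1 + t)) := by
    have := hdec (1 - μ) (by linarith)
    rw [show 1 - μ = -μ + 1 by ring] at this ⊢
    rwa [Real.rpow_add_one hcw] at this
  have b1 : ‖velocity a y η - η‖ ≤ C * M * D := by
    calc _ ≤ _ := hv y η
      _ ≤ C * D * M := by gcongr
      _ = _ := by ring
  have b2 : (1 + t) * ‖kinGrad a y η‖ ≤ C * M ^ 2 / c * D := by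
    calc _ ≤ (1 + t) * (C * (D / (c * (1 + t))) * M ^ 2) := by
          refine mul_le_mul_of_nonneg_left ((hk y η).trans ?_) hw.le
          gcongr
      _ = _ := by field_simp
  have b3 : ‖potGrad V y‖ ≤ C * (D * (c * (1 + t))) :=
    (hp y).trans (mul_le_mul_of_nonneg_left d3 hC.le)
  have hsin : |Real.sin (t / lam)| ≤ t / lam := by
    have := Real.abs_sin_le_abs (x := t / lam)
    rwa [abs_of_nonneg (a := t / lam) (by positivity)] at this
  have hsin1 := Real.abs_sin_le_one (t / lam)
  have hcos := Real.abs_cos_le_one (t / lam)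
  have hb3' : (1 + t) / lam ^ 2 * ‖potGrad V y‖ ≤ C * c * (1 + σ) ^ 2 * D := by
    have h1 : 1 + t ≤ (1 + σ) * lam := by nlinarith
    have h2 : (1 + t) ^ 2 / lam ^ 2 ≤ (1 + σ) ^ 2 := by
      rw [div_le_iff₀ (by positivity), ← mul_pow]
      gcongr
    calc (1 + t) / lam ^ 2 * ‖potGrad V y‖ ≤ (1 + t) / lam ^ 2 * (C * (D * (c * (1 + t)))) := by
          gcongr
      _ = C * c * D * ((1 + t) ^ 2 / lam ^ 2) := by ring
      _ ≤ C * c * D * (1 + σ) ^ 2 := by gcongr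
      _ = _ := by ring
  have hfin : (C * M + C * M ^ 2 / c + C * c * (1 + σ) ^ 2) * c ^ (-μ) * (1 + t) ^ (-μ)
      = C * M * D + C * M ^ 2 / c * D + C * c * (1 + σ) ^ 2 * D := by
    rw [hDeq]
    ring
  rw [hfin]
  constructor
  · refine (norm_add₃_le).trans ?_
    rw [norm_smul, norm_smul, norm_smul, Real.norm_eq_abs, Real.norm_eq_abs, Real.norm_eq_abs,
      abs_mul, abs_div, abs_of_pos hl0]
    refine add_le_add (add_le_add ?_ ?_) ?_
    · exact (mul_le_of_le_one_left (norm_nonneg _) hcos).trans b1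
    · refine (mul_le_mul_of_nonneg_right ?_ (norm_nonneg _)).trans b2
      have := mul_le_mul_of_nonneg_left hsin hl0.le
      rw [mul_div_cancel₀ _ hl0.ne'] at this
      linarith
    · refine (mul_le_mul_of_nonneg_right ?_ (norm_nonneg _)).trans hb3'
      rw [pow_two, ← div_div]
      gcongr
      refine hsin.trans ?_
      gcongr
      linarith
  · refine (norm_sub_le_of_le (norm_sub_le _ _) le_rfl).trans ?_
    rw [norm_smul, norm_smul, norm_smul, Real.norm_eq_abs, Real.norm_eq_abs, Real.norm_eq_abs,
      abs_div, abs_div, abs_of_pos hl0, abs_of_pos (pow_pos hl0 2)]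
    refine add_le_add (add_le_add ?_ ?_) ?_
    · refine (mul_le_of_le_one_left (norm_nonneg _) ?_).trans b1
      rw [div_le_one hl0]
      linarith
    · refine (mul_le_mul_of_nonneg_right ?_ (norm_nonneg _)).trans b2
      linarith
    · refine (mul_le_mul_of_nonneg_right ?_ (norm_nonneg _)).trans hb3'
      gcongr
      linarith

lemma AssumptionA.contDiff_kineticField (hA : AssumptionA n a V μ) :
    ContDiff ℝ 1 fun p : En n × En n => (velocity a p.1 p.2, -kinGrad a p.1 p.2) := by
  have hcoord : ∀ j : Fin n, ContDiff ℝ 1 fun p : En n × En n => p.2 j := fun j =>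
    contDiff_euclidean.1 contDiff_snd j
  have ha : ∀ j k, ContDiff ℝ 1 fun p : En n × En n => a j k p.1 := fun j k =>
    ((hA.smooth_a j k).of_le (by exact_mod_cast le_top)).comp contDiff_fst
  have hpd : ∀ i l j, ContDiff ℝ 1 fun p : En n × En n => pd (a i l) j p.1 := fun i l j =>
    (((hA.smooth_a i l).fderiv_right (m := 1)
      (WithTop.coe_le_coe.2 (le_top : (1 + 1 : ℕ∞) ≤ ⊤))).clm_apply
      contDiff_const).comp contDiff_fst
  refine ContDiff.prodMk (contDiff_euclidean.2 fun j => ?_)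
    (ContDiff.neg (contDiff_euclidean.2 fun j => ?_))
  · simp only [velocity]
    exact ContDiff.sum fun i _ => (ha j i).mul (hcoord i)
  · simp only [kinGrad]
    exact contDiff_const.mul (ContDiff.sum fun i _ => ContDiff.sum fun l _ =>
      ((hpd i l j).mul (hcoord i)).mul (hcoord l))

/-- At a fixed time, the flow of `p^λ` converges to the flow of `k` as `λ → ∞`. -/
lemma AssumptionA.tendsto_flow (hA : AssumptionA n a V μ) {x ξ : En n} {ty tη : ℝ → En n}
    (hk : IsFlowK a ty tη) (hty0 : ty 0 = x) (htη0 : tη 0 = ξ) {Y H : ℝ → ℝ → En n}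
    (hYH : ∀ lam : ℝ, 0 < lam →
      IsFlowPlam a V lam (Y lam) (H lam) ∧ Y lam 0 = x ∧ H lam 0 = ξ) {T : ℝ} (hT : 0 ≤ T) :
    Tendsto (fun lam => (Y lam T, H lam T)) atTop (𝓝 (ty T, tη T)) := by
  obtain ⟨C, hC, hv, -, hp, -⟩ := hA.exists_field_bound
  obtain ⟨M, hM, hη⟩ := hA.exists_momentum_bound x ξ
  have hle1 : ∀ (z : En n) (s : ℝ), s ≤ 0 → C * jb z ^ s ≤ C := fun z s hs =>
    mul_le_of_le_one_right hC.le (Real.rpow_le_one_of_one_le_of_nonpos (one_le_jb z) hs)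
  set R := ‖x‖ + (C + 1) * M * T with hR
  have hY : ∀ lam, 1 ≤ lam → ∀ t ∈ Set.Icc 0 T, ‖Y lam t‖ ≤ R := by
    intro lam hlam t ht
    obtain ⟨hf, h0, h0'⟩ := hYH lam (by linarith)
    have h := norm_image_sub_le_of_norm_deriv_le_segment' (a := 0) (b := T) (C := (C + 1) * M)
      (fun s _ => (hf.hasDerivAt_fst s).hasDerivWithinAt) (fun s _ => ?_) t ht
    · rw [h0, sub_zero] at h
      have h2 : (C + 1) * M * t ≤ (C + 1) * M * T := by
        have := ht.2
        gcongr
      linarith [norm_le_norm_add_norm_sub' (Y lam t) x]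
    · have e1 := hη lam hlam _ _ hf h0 h0' s
      have e2 := hv (Y lam s) (H lam s)
      have e3 : C * jb (Y lam s) ^ (-μ) * ‖H lam s‖ ≤ C * M :=
        mul_le_mul (hle1 _ _ (by linarith [hA.one_lt_mu])) e1 (norm_nonneg _) hC.le
      linarith [norm_le_norm_add_norm_sub' (velocity a (Y lam s) (H lam s)) (H lam s)]
  have hgc : Continuous fun t => (ty t, tη t) :=
    (continuous_iff_continuousAt.2 fun t => (hk.hasDerivAt_fst t).continuousAt).prodMk
      (continuous_iff_continuousAt.2 fun t => (hk.hasDerivAt_snd t).continuousAt)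
  obtain ⟨Q, hQ⟩ := (isCompact_Icc (a := 0) (b := T)).exists_bound_of_continuousOn hgc.continuousOn
  set S := Metric.closedBall (0 : En n × En n) (max Q (max R M))
  obtain ⟨L, hL⟩ := hA.contDiff_kineticField.contDiffOn (s := S) |>.exists_lipschitzOnWith
    one_ne_zero (convex_closedBall _ _) (isCompact_closedBall _ _)
  have hdist : ∀ lam, 1 ≤ lam → dist (Y lam T, H lam T) (ty T, tη T)
      ≤ gronwallBound 0 L ((lam ^ 2)⁻¹ * (R + C)) T := by
    intro lam hlam
    obtain ⟨hf, h0, h0'⟩ := hYH lam (by linarith)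
    have hfd := fun t => (hf.hasDerivAt_fst t).prodMk (hf.hasDerivAt_snd t)
    have hgd := fun t => (hk.hasDerivAt_fst t).prodMk (hk.hasDerivAt_snd t)
    have h := dist_le_of_approx_trajectories_ODE_of_mem (a := 0) (b := T) (s := fun _ => S)
      (v := fun _ p => (velocity a p.1 p.2, -kinGrad a p.1 p.2)) (δ := 0)
      (εf := (lam ^ 2)⁻¹ * (R + C)) (εg := 0) (fun _ _ => hL)
      (fun t _ => (hfd t).continuousAt.continuousWithinAt)
      (fun t _ => (hfd t).hasDerivWithinAt) (fun t ht => ?_) (fun t ht => ?_)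
      hgc.continuousOn (fun t _ => (hgd t).hasDerivWithinAt) (fun t _ => (dist_self _).le)
      (fun t ht => ?_) (by simp [h0, h0', hty0, htη0]) T (Set.right_mem_Icc.2 hT)
    · simpa using h
    · have hy := hY lam hlam t (Set.Ico_subset_Icc_self ht)
      have hpot := (hp (Y lam t)).trans (hle1 _ _ (by linarith [hA.one_lt_mu]))
      have e : (0 : ℝ) ≤ (lam ^ 2)⁻¹ := by positivity
      rw [Prod.dist_eq]
      refine max_le ?_ ?_
      · simp only [dist_self]
        exact mul_nonneg e (by linarith [norm_nonneg (Y lam t)])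
      · rw [dist_eq_norm, sub_neg_eq_add, neg_add_rev, neg_add_cancel_right, norm_neg, norm_smul,
          Real.norm_of_nonneg e]
        exact mul_le_mul_of_nonneg_left ((norm_add_le _ _).trans (add_le_add hy hpot)) e
    · rw [mem_closedBall_zero_iff, Prod.norm_def]
      exact max_le
        ((hY lam hlam t (Set.Ico_subset_Icc_self ht)).trans
          ((le_max_left _ _).trans (le_max_right _ _)))
        ((hη lam hlam _ _ hf h0 h0' t).trans ((le_max_right _ _).trans (le_max_right _ _)))
    · rw [mem_closedBall_zero_iff]
      exact (hQ t (Set.Ico_subset_Icc_self ht)).trans (le_max_left _ _)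
  rw [tendsto_iff_dist_tendsto_zero]
  have hε : Tendsto (fun lam : ℝ => (lam ^ 2)⁻¹ * (R + C)) atTop (𝓝 0) := by
    simpa using ((tendsto_pow_atTop (two_ne_zero)).inv_tendsto_atTop (𝕜 := ℝ)).mul_const (R + C)
  have hlim := ((gronwallBound_continuous_ε 0 L T).tendsto 0).comp hε
  rw [gronwallBound_ε0_δ0] at hlim
  exact squeeze_zero' (Eventually.of_forall fun _ => dist_nonneg)
    ((eventually_ge_atTop 1).mono hdist) hlim

/-- At a fixed time, the interaction picture for the harmonic flow converges to the one for the
free flow. -/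
lemma tendsto_interaction {Y H : ℝ → ℝ → En n} {T : ℝ} {y η : En n}
    (h : Tendsto (fun lam => (Y lam T, H lam T)) atTop (𝓝 (y, η))) :
    Tendsto (fun lam => zlam lam (Y lam) (H lam) T) atTop (𝓝 (y - T • η)) ∧
      Tendsto (fun lam => zetalam lam (Y lam) (H lam) T) atTop (𝓝 η) := by
  have hy : Tendsto (fun lam => Y lam T) atTop (𝓝 y) := (continuous_fst.tendsto _).comp h
  have hη : Tendsto (fun lam => H lam T) atTop (𝓝 η) := (continuous_snd.tendsto _).comp h
  have hq : Tendsto (fun lam : ℝ => T / lam) atTop (𝓝 0) := tendsto_id.const_div_atTop T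
  have hcos : Tendsto (fun lam : ℝ => Real.cos (T / lam)) atTop (𝓝 1) := by
    simpa [Function.comp_def] using (Real.continuous_cos.tendsto 0).comp hq
  have hsin : Tendsto (fun lam : ℝ => Real.sin (T / lam)) atTop (𝓝 0) := by
    simpa [Function.comp_def] using (Real.continuous_sin.tendsto 0).comp hq
  have hsinc : Tendsto (fun lam : ℝ => lam * Real.sin (T / lam)) atTop (𝓝 T) := by
    have h1 : Tendsto (fun lam : ℝ => T * Real.sinc (T / lam)) atTop (𝓝 T) := by
      simpa using ((Real.continuous_sinc.tendsto 0).comp hq).const_mul T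
    refine h1.congr' ((eventually_ne_atTop 0).mono fun lam hlam => ?_)
    rcases eq_or_ne T 0 with rfl | hT
    · simp
    · rw [Real.sinc_of_ne_zero (div_ne_zero hT hlam)]
      field_simp
  constructor
  · simpa [zlam] using (hcos.smul hy).sub (hsinc.smul hη)
  · simpa [zetalam] using ((tendsto_inv_atTop_zero.mul hsin).smul hy).add (hcos.smul hη)

/-- If `f λ` stays eventually within `b T` of `g T λ`, where `b T → 0`, and `g T λ → ℓ T` as
`λ → ∞` with `ℓ T → L`, then `f λ → L`. -/
lemma tendsto_of_uniform_approx {E : Type*} [PseudoMetricSpace E] {f : ℝ → E} {g : ℝ → ℝ → E}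
    {ℓ : ℝ → E} {L : E} {b : ℝ → ℝ} (hb : Tendsto b atTop (𝓝 0)) (hℓ : Tendsto ℓ atTop (𝓝 L))
    (hg : ∀ T, 0 ≤ T → Tendsto (g T) atTop (𝓝 (ℓ T)))
    (hfg : ∀ T, 0 ≤ T → ∀ᶠ lam in atTop, dist (f lam) (g T lam) ≤ b T) :
    Tendsto f atTop (𝓝 L) := by
  rw [Metric.tendsto_nhds]
  intro ε hε
  obtain ⟨T, hT0, hbT, hℓT⟩ := ((eventually_ge_atTop (0 : ℝ)).and
    ((hb.eventually_lt_const (show (0 : ℝ) < ε / 3 by positivity)).and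
      (Metric.tendsto_nhds.1 hℓ (ε / 3) (by positivity)))).exists
  filter_upwards [hfg T hT0, Metric.tendsto_nhds.1 (hg T hT0) (ε / 3) (by positivity)]
    with lam h1 h2
  linarith [dist_triangle4 (f lam) (g T lam) (ℓ T) L]

end Estimates

/-- Lemma 2.2. Under Assumption A, suppose `(x₀,ξ₀)` is forward
nontrapping for `k` and `δ > 0`, `Ω ∋ (x₀,ξ₀)` are as in the escape estimate. Then for
every `σ ∈ (0,δ)` and `(x,ξ) ∈ Ω`,
`lim_{λ→∞} exp(−σλH_{p₀^λ}) ∘ exp(σλH_{p^λ})(x,ξ) = S₊(x,ξ)`, where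
`S₊(x,ξ) = lim_{t→+∞} exp(−tH_{k₀}) ∘ exp(tH_k)(x,ξ)`. -/
theorem stmt_11 {n : ℕ} (a : Fin n → Fin n → En n → ℝ) (V : En n → ℝ) (μ : ℝ)
    (hA : AssumptionA n a V μ) (x₀ ξ₀ : En n)
    -- forward nontrapping of (x₀,ξ₀):
    (y₀ η₀ : ℝ → En n) (hflow₀ : IsFlowK a y₀ η₀) (hy₀ : y₀ 0 = x₀) (hη₀ : η₀ 0 = ξ₀)
    (hnt : Filter.Tendsto (fun t => ‖y₀ t‖) Filter.atTop Filter.atTop)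
    -- δ and Ω as in the escape estimate (Lemma 2.1):
    (δ : ℝ) (hδ : 0 < δ) (Ω : Set (En n × En n)) (hΩ : IsOpen Ω) (hmem : (x₀, ξ₀) ∈ Ω)
    (lam₀ c₁ c₂ : ℝ) (hlam₀ : 0 < lam₀) (hc₁ : 0 < c₁) (hc₂ : 0 < c₂)
    (hescape : ∀ lam : ℝ, lam₀ ≤ lam → ∀ x ξ : En n, (x, ξ) ∈ Ω →
      ∀ y η : ℝ → En n, IsFlowPlam a V lam y η → y 0 = x → η 0 = ξ →
        ∀ t : ℝ, 0 ≤ t → t ≤ lam * δ → c₁ * t - c₂ ≤ ‖y t‖)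
    -- σ ∈ (0,δ) and (x,ξ) ∈ Ω:
    (σ : ℝ) (hσ0 : 0 < σ) (hσδ : σ < δ) (x ξ : En n) (hxξ : (x, ξ) ∈ Ω)
    -- classical scattering data S₊(x,ξ) = (x₊,ξ₊):
    (ty tη : ℝ → En n) (hk : IsFlowK a ty tη) (hty0 : ty 0 = x) (htη0 : tη 0 = ξ)
    (xp ξp : En n)
    (hxp : Filter.Tendsto (fun t : ℝ => ty t - t • tη t) Filter.atTop (nhds xp))
    (hξp : Filter.Tendsto tη Filter.atTop (nhds ξp))
    -- the flows of p^λ with initial data (x,ξ):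
    (Y H : ℝ → ℝ → En n)
    (hYH : ∀ lam : ℝ, 0 < lam →
      IsFlowPlam a V lam (Y lam) (H lam) ∧ Y lam 0 = x ∧ H lam 0 = ξ) :
    Filter.Tendsto (fun lam : ℝ =>
        (zlam lam (Y lam) (H lam) (σ * lam), zetalam lam (Y lam) (H lam) (σ * lam)))
      Filter.atTop (nhds (xp, ξp)) := by
  obtain ⟨M, hM, hη⟩ := hA.exists_momentum_bound x ξ
  obtain ⟨K, hK, hderiv⟩ := hA.exists_deriv_bound hc₁ hc₂ hσ0 hM
  have hμ := hA.one_lt_mu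
  have hb : Tendsto (fun T : ℝ => K / (μ - 1) * (1 + T) ^ (1 - μ)) atTop (𝓝 0) := by
    have h1 : Tendsto (fun T : ℝ => (1 + T) ^ (-(μ - 1))) atTop (𝓝 0) :=
      (tendsto_rpow_neg_atTop (by linarith)).comp (tendsto_atTop_add_const_left _ 1 tendsto_id)
    simpa using h1.const_mul (K / (μ - 1))
  have htail : ∀ T, 0 ≤ T → ∀ᶠ lam in atTop,
      dist (zlam lam (Y lam) (H lam) (σ * lam)) (zlam lam (Y lam) (H lam) T)
          ≤ K / (μ - 1) * (1 + T) ^ (1 - μ) ∧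
        dist (zetalam lam (Y lam) (H lam) (σ * lam)) (zetalam lam (Y lam) (H lam) T)
          ≤ K / (μ - 1) * (1 + T) ^ (1 - μ) := by
    intro T hT
    filter_upwards [eventually_ge_atTop lam₀, eventually_ge_atTop 1,
      eventually_ge_atTop (T / σ)] with lam hl₀ hl1 hlT
    have hTb : T ≤ σ * lam := by rwa [div_le_iff₀' hσ0] at hlT
    obtain ⟨hf, h0, h0'⟩ := hYH lam (by linarith)
    have hbd := fun t (ht : t ∈ Set.Icc T (σ * lam)) =>
      hderiv lam t (Y lam t) (H lam t) hl1 (hT.trans ht.1) ht.2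
        (hescape lam hl₀ x ξ hxξ _ _ hf h0 h0' t (hT.trans ht.1) (by nlinarith [ht.2]))
        (hη lam hl1 _ _ hf h0 h0' t)
    rw [dist_eq_norm, dist_eq_norm]
    exact ⟨norm_sub_le_of_deriv_le_rpow hμ hK.le hT hTb
        (fun t _ => hf.hasDerivAt_zlam (by linarith) t) fun t ht => (hbd t ht).1,
      norm_sub_le_of_deriv_le_rpow hμ hK.le hT hTb
        (fun t _ => hf.hasDerivAt_zetalam (by linarith) t) fun t ht => (hbd t ht).2⟩
  have hfix := fun T hT => tendsto_interaction (hA.tendsto_flow hk hty0 htη0 hYH (T := T) hT)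
  exact (tendsto_of_uniform_approx hb hxp (fun T hT => (hfix T hT).1)
      fun T hT => (htail T hT).mono fun _ h => h.1).prodMk_nhds
    (tendsto_of_uniform_approx hb hξp (fun T hT => (hfix T hT).2)
      fun T hT => (htail T hT).mono fun _ h => h.2)
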